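/- For all real a, b with a < −n, every integer n ≥ 2 and every x ∈ ℂ, the monic Pseudo-Jacobi polynomials satisfy the mixed three-term recurrence P_n(x;a,b) = [(2a+n)/(2a+2n−1)] · (x + b/(a+n)) · P_{n−1}(x;a,b) + [(n−1)(x²+1)/(2a+2n−1)] · P_{n−2}(x;a+1,b). -/

import Mathlib

open scoped BigOperators

/-- Pochhammer symbol `(α)_j = α(α+1)⋯(α+j−1)` in a commutative semiring. -/
noncomputable def poch {R : Type*} [CommSemiring R] (α : R) (j : ℕ) : R :=
  ∏ i ∈ Finset.range j, (α + i)

/-- The monic Pseudo-Jacobi polynomial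
`P_n(x;a,b) = [2ⁿ (a+ib+1)_n / (iⁿ (2a+n+1)_n)] ·
  Σ_{j=0}^{n} [(−n)_j (2a+n+1)_j / ((a+ib+1)_j · j!)] ((1−ix)/2)^j`. -/
noncomputable def pseudoJacobi (a b : ℝ) (n : ℕ) (x : ℂ) : ℂ :=
  2 ^ n * poch ((a : ℂ) + Complex.I * (b : ℂ) + 1) n /
      (Complex.I ^ n * poch (2 * (a : ℂ) + (n : ℂ) + 1) n) *
    ∑ j ∈ Finset.range (n + 1),
      poch (-(n : ℂ)) j * poch (2 * (a : ℂ) + (n : ℂ) + 1) j /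
          (poch ((a : ℂ) + Complex.I * (b : ℂ) + 1) j * (j.factorial : ℂ)) *
        ((1 - Complex.I * x) / 2) ^ j

theorem poch_zero {R : Type*} [CommSemiring R] (α : R) : poch α 0 = 1 := by
  simp [poch]

theorem poch_succ {R : Type*} [CommSemiring R] (α : R) (j : ℕ) :
    poch α (j + 1) = poch α j * (α + j) :=
  Finset.prod_range_succ _ _

theorem poch_succ' {R : Type*} [CommSemiring R] (α : R) (j : ℕ) :
    poch α (j + 1) = α * poch (α + 1) j := by
  simp [poch, Finset.prod_range_succ', mul_comm, add_assoc, add_comm (1 : R)]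

theorem poch_ne_zero {K : Type*} [Field K] {α : K} {j : ℕ}
    (h : ∀ i < j, α + i ≠ 0) : poch α j ≠ 0 :=
  Finset.prod_ne_zero_iff.2 fun i hi => h i (Finset.mem_range.1 hi)

theorem poch_neg_natCast_succ {R : Type*} [CommRing R] (n : ℕ) :
    poch (-(n : R)) (n + 1) = 0 := by
  simp [poch_succ]

/-- Coefficient of `z ^ j` in the terminating series `₂F₁(-n, B; C; z)`. -/
noncomputable def hypergeometricCoeff {K : Type*} [Field K] (B C : K) (n j : ℕ) : K :=
  poch (-(n : K)) j * poch B j / (poch C j * (j.factorial : K))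

/-- Comparison of coefficients in `s * c = (d - p z) e - q z (1 - z) g`. -/
theorem sum_mul_pow_eq_of_coeff_eq {R : Type*} [CommRing R] (m : ℕ) (c e g : ℕ → R)
    (s d p q z : R) (he : e (m + 2) = 0) (hg : g (m + 1) = 0)
    (h0 : s * c 0 = d * e 0) (h1 : s * c 1 = d * e 1 - p * e 0 - q * g 0)
    (h2 : ∀ j ≤ m, s * c (j + 2) = d * e (j + 2) - p * e (j + 1) - q * g (j + 1) + q * g j) :
    s * ∑ j ∈ Finset.range (m + 3), c j * z ^ j =
      (d - p * z) * ∑ j ∈ Finset.range (m + 2), e j * z ^ j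
        - q * z * (1 - z) * ∑ j ∈ Finset.range (m + 1), g j * z ^ j := by
  have hc : ∑ j ∈ Finset.range (m + 3), c j * z ^ j =
      z ^ 2 * ∑ j ∈ Finset.range (m + 1), c (j + 2) * z ^ j + c 1 * z + c 0 := by
    rw [Finset.sum_range_succ', Finset.sum_range_succ', Finset.mul_sum]
    simp only [zero_add, pow_zero, pow_one, mul_one]
    congr 2
    exact Finset.sum_congr rfl fun j _ => by ring
  have he1 : ∑ j ∈ Finset.range (m + 2), e j * z ^ j =
      z * ∑ j ∈ Finset.range (m + 1), e (j + 1) * z ^ j + e 0 := by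
    rw [Finset.sum_range_succ', Finset.mul_sum]
    simp only [pow_zero, mul_one]
    congr 1
    exact Finset.sum_congr rfl fun j _ => by ring
  have he2 : z * ∑ j ∈ Finset.range (m + 1), e (j + 1) * z ^ j =
      z ^ 2 * ∑ j ∈ Finset.range (m + 1), e (j + 2) * z ^ j + e 1 * z := by
    rw [Finset.sum_range_succ', Finset.sum_range_succ _ m, he, zero_mul, add_zero, mul_add,
      Finset.mul_sum, Finset.mul_sum]
    simp only [zero_add, pow_zero, mul_one, mul_comm z (e 1)]
    congr 1
    exact Finset.sum_congr rfl fun j _ => by ring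
  have hg1 : ∑ j ∈ Finset.range (m + 1), g j * z ^ j =
      z * ∑ j ∈ Finset.range (m + 1), g (j + 1) * z ^ j + g 0 := by
    rw [Finset.sum_range_succ', Finset.sum_range_succ _ m, hg, zero_mul, add_zero,
      Finset.mul_sum]
    simp only [pow_zero, mul_one]
    congr 1
    exact Finset.sum_congr rfl fun j _ => by ring
  have hsum : s * ∑ j ∈ Finset.range (m + 1), c (j + 2) * z ^ j =
      d * ∑ j ∈ Finset.range (m + 1), e (j + 2) * z ^ j
        - p * ∑ j ∈ Finset.range (m + 1), e (j + 1) * z ^ j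
        - q * ∑ j ∈ Finset.range (m + 1), g (j + 1) * z ^ j
        + q * ∑ j ∈ Finset.range (m + 1), g j * z ^ j := by
    simp only [Finset.mul_sum, ← Finset.sum_sub_distrib, ← Finset.sum_add_distrib]
    refine Finset.sum_congr rfl fun j hj => ?_
    linear_combination z ^ j * h2 j (by simpa [Nat.lt_succ_iff] using hj)
  linear_combination s * hc + z ^ 2 * hsum + z * h1 + h0 - d * he1 - d * he2
    + p * z * he1 + q * z * hg1

/-- Contiguous relation for terminating Gauss hypergeometric sums. -/
theorem hypergeometricCoeff_sum_contiguous {K : Type*} [Field K] [CharZero K] (a α z : K) (m : ℕ)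
    (hα : ∀ i : ℕ, i ≤ m + 1 → α + 1 + i ≠ 0) :
    (α + 1) * (α + m + 2) * ∑ j ∈ Finset.range (m + 3),
        hypergeometricCoeff (2 * a + m + 3) (α + 1) (m + 2) j * z ^ j =
      ((α + 1) * (α + m + 2) - 2 * (a + m + 2) * (α + 1) * z) *
          ∑ j ∈ Finset.range (m + 2),
            hypergeometricCoeff (2 * a + m + 2) (α + 1) (m + 1) j * z ^ j
        - 2 * (m + 1) * (a + m + 2) * z * (1 - z) *
          ∑ j ∈ Finset.range (m + 1),
            hypergeometricCoeff (2 * a + m + 3) (α + 2) m j * z ^ j := by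
  have hα1 : α + 1 ≠ 0 := by simpa using hα 0 (by omega)
  apply sum_mul_pow_eq_of_coeff_eq
  · have := poch_neg_natCast_succ (R := K) (m + 1)
    simp only [hypergeometricCoeff, this, zero_mul, zero_div]
  · simp only [hypergeometricCoeff, poch_neg_natCast_succ, zero_mul, zero_div]
  · simp [hypergeometricCoeff, poch_zero]
  · simp only [hypergeometricCoeff, poch_zero, poch_succ _ 0, Nat.factorial]
    push_cast
    simp only [add_zero, one_mul, mul_one, div_one]
    field_simp
    ring
  · intro j hj
    have hs : poch (α + 2) j ≠ 0 := poch_ne_zero fun i hi => by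
      have := hα (i + 1) (by omega)
      push_cast at this
      convert this using 1
      ring
    have hαj : α + 2 + j ≠ 0 := by
      have := hα (j + 1) (by omega)
      push_cast at this
      convert this using 1
      ring
    have hf : (j.factorial : K) ≠ 0 := Nat.cast_ne_zero.2 j.factorial_ne_zero
    have hj1 : (j : K) + 1 ≠ 0 := Nat.cast_add_one_ne_zero j
    have hj2 : (j : K) + 1 + 1 ≠ 0 := by exact_mod_cast Nat.succ_ne_zero (j + 1)
    have n2 : poch (-((m + 2 : ℕ) : K)) (j + 2) = (m + 2) * (m + 1) * poch (-(m : K)) j := by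
      rw [poch_succ', poch_succ']
      push_cast
      rw [show -((m : K) + 2) + 1 + 1 = -m by ring]
      ring
    have n1 : poch (-((m + 1 : ℕ) : K)) (j + 1) = -(m + 1) * poch (-(m : K)) j := by
      rw [poch_succ']
      push_cast
      rw [show -((m : K) + 1) + 1 = -m by ring]
    have n1' : poch (-((m + 1 : ℕ) : K)) (j + 2) =
        -(m + 1) * poch (-(m : K)) j * (j - m) := by
      rw [poch_succ, n1]
      push_cast
      ring
    have b1 : poch (2 * a + m + 2) (j + 1) = (2 * a + m + 2) * poch (2 * a + m + 3) j := by
      rw [poch_succ', show 2 * a + m + 2 + 1 = 2 * a + m + 3 by ring]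
    have c1 : poch (α + 1) (j + 1) = (α + 1) * poch (α + 2) j := by
      rw [poch_succ', show α + 1 + 1 = α + 2 by ring]
    have c2 : poch (α + 1) (j + 2) = (α + 1) * poch (α + 2) j * (α + 2 + j) := by
      rw [poch_succ, c1]
      push_cast
      ring
    simp only [hypergeometricCoeff, n2, n1, n1', c1, c2, poch_succ (2 * a + m + 2) (j + 1), b1,
      poch_succ (2 * a + (m : K) + 3), poch_succ (α + 2), poch_succ (-(m : K)), Nat.factorial]
    push_cast
    field_simp
    ring

theorem pseudoJacobi_eq_hypergeometricCoeff_sum (a b : ℝ) (n : ℕ) (x : ℂ) :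
    pseudoJacobi a b n x =
      2 ^ n * poch ((a : ℂ) + Complex.I * b + 1) n /
          (Complex.I ^ n * poch (2 * (a : ℂ) + n + 1) n) *
        ∑ j ∈ Finset.range (n + 1),
          hypergeometricCoeff (2 * (a : ℂ) + n + 1) ((a : ℂ) + Complex.I * b + 1) n j *
            ((1 - Complex.I * x) / 2) ^ j :=
  rfl

/-- **Mixed recurrence (4.2) for Pseudo-Jacobi polynomials:** for `a < −n`, `n ≥ 2`,
`P_n(x;a,b) = [(2a+n)/(2a+2n−1)]·(x + b/(a+n))·P_{n−1}(x;a,b)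
  + [(n−1)(x²+1)/(2a+2n−1)]·P_{n−2}(x;a+1,b)`. -/
theorem pseudoJacobi_mixed_recurrence_shift_one (a b : ℝ) (n : ℕ) (hn : 2 ≤ n)
    (ha : a < -(n : ℝ)) (x : ℂ) :
    pseudoJacobi a b n x =
      (2 * (a : ℂ) + (n : ℂ)) / (2 * (a : ℂ) + 2 * (n : ℂ) - 1) *
          (x + (b : ℂ) / ((a : ℂ) + (n : ℂ))) * pseudoJacobi a b (n - 1) x +
        ((n : ℂ) - 1) * (x ^ 2 + 1) / (2 * (a : ℂ) + 2 * (n : ℂ) - 1) *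
          pseudoJacobi (a + 1) b (n - 2) x := by
  obtain ⟨m, rfl⟩ := Nat.exists_eq_add_of_le' hn
  rw [show m + 2 - 1 = m + 1 by omega, Nat.add_sub_cancel]
  push_cast at ha
  have hm : (0 : ℝ) ≤ m := m.cast_nonneg
  have hα : ∀ i : ℕ, i ≤ m + 1 → (a : ℂ) + Complex.I * b + 1 + i ≠ 0 := by
    intro i hi h
    have h' := congrArg Complex.re h
    have hi' : (i : ℝ) ≤ m + 1 := by exact_mod_cast hi
    simp at h'
    linarith
  have hv : poch (2 * (a : ℂ) + m + 3) m ≠ 0 := poch_ne_zero fun i hi h => by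
    have hi' : (i : ℝ) ≤ m := by exact_mod_cast hi.le
    have h' : 2 * a + m + 3 + i = 0 := by exact_mod_cast h
    linarith
  have hD : 2 * (a : ℂ) + 2 * m + 3 ≠ 0 := fun h => by
    have h' : 2 * a + 2 * m + 3 = 0 := by exact_mod_cast h
    linarith
  have hA : (a : ℂ) + m + 2 ≠ 0 := fun h => by
    have h' : a + m + 2 = 0 := by exact_mod_cast h
    linarith
  have hE : 2 * (a : ℂ) + m + 2 ≠ 0 := fun h => by
    have h' : 2 * a + m + 2 = 0 := by exact_mod_cast h
    linarith
  have key := hypergeometricCoeff_sum_contiguous (a : ℂ) (a + Complex.I * b)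
    ((1 - Complex.I * x) / 2) m hα
  simp only [pseudoJacobi_eq_hypergeometricCoeff_sum]
  push_cast
  rw [show 2 * (a : ℂ) + (m + 2) + 1 = 2 * a + m + 3 by ring,
    show 2 * (a : ℂ) + (m + 1) + 1 = 2 * a + m + 2 by ring,
    show 2 * ((a : ℂ) + 1) + m + 1 = 2 * a + m + 3 by ring,
    show (a : ℂ) + 1 + Complex.I * b + 1 = a + Complex.I * b + 2 by ring,
    show 2 * (a : ℂ) + 2 * (m + 2) - 1 = 2 * a + 2 * m + 3 by ring,
    show 2 * (a : ℂ) + (m + 2) = 2 * a + m + 2 by ring,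
    show (a : ℂ) + (m + 2) = a + m + 2 by ring,
    show m + 2 + 1 = m + 3 by rfl, show m + 1 + 1 = m + 2 by rfl]
  have v2 : poch (2 * (a : ℂ) + m + 3) (m + 2) =
      poch (2 * (a : ℂ) + m + 3) m * (2 * a + 2 * m + 3) * (2 * (a + m + 2)) := by
    rw [poch_succ, poch_succ]
    push_cast
    ring
  have v1 : poch (2 * (a : ℂ) + m + 2) (m + 1) =
      (2 * a + m + 2) * poch (2 * (a : ℂ) + m + 3) m := by
    rw [poch_succ', show 2 * (a : ℂ) + m + 2 + 1 = 2 * a + m + 3 by ring]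
  have u1 : poch ((a : ℂ) + Complex.I * b + 1) (m + 1) =
      (a + Complex.I * b + 1) * poch ((a : ℂ) + Complex.I * b + 2) m := by
    rw [poch_succ', show (a : ℂ) + Complex.I * b + 1 + 1 = a + Complex.I * b + 2 by ring]
  have u2 : poch ((a : ℂ) + Complex.I * b + 1) (m + 2) =
      (a + Complex.I * b + 1) * poch ((a : ℂ) + Complex.I * b + 2) m *
        (a + Complex.I * b + m + 2) := by
    rw [poch_succ, u1]
    push_cast
    ring
  rw [v1, v2, u1, u2]
  generalize poch (2 * (a : ℂ) + m + 3) m = v at *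
  generalize poch ((a : ℂ) + Complex.I * b + 2) m = u
  generalize (∑ j ∈ Finset.range (m + 3), _ : ℂ) = S₂ at *
  generalize (∑ j ∈ Finset.range (m + 2), _ : ℂ) = S₁ at *
  generalize (∑ j ∈ Finset.range (m + 1), _ : ℂ) = S₀ at *
  have hI : Complex.I ^ 2 = -1 := Complex.I_sq
  have hI0 : Complex.I ≠ 0 := Complex.I_ne_zero
  have hIm : Complex.I ^ m ≠ 0 := pow_ne_zero _ hI0
  have e2 : 2 ^ (m + 2) * ((a + Complex.I * b + 1) * u * (a + Complex.I * b + m + 2)) /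
      (Complex.I ^ (m + 2) * (v * (2 * a + 2 * m + 3) * (2 * (a + m + 2)))) =
      2 ^ m * u / (Complex.I ^ m * v) * (-2 * ((a + Complex.I * b + 1) *
        (a + Complex.I * b + m + 2)) / ((2 * a + 2 * m + 3) * (a + m + 2))) := by
    rw [pow_add Complex.I, hI]
    field_simp
    ring
  have e1 : 2 ^ (m + 1) * ((a + Complex.I * b + 1) * u) /
      (Complex.I ^ (m + 1) * ((2 * a + m + 2) * v)) =
      2 ^ m * u / (Complex.I ^ m * v) * (-2 * Complex.I * (a + Complex.I * b + 1) /
        (2 * a + m + 2)) := by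
    rw [pow_succ Complex.I, div_mul_div_comm, div_eq_div_iff (by positivity) (by positivity)]
    linear_combination 2 ^ (m + 1) * ((a + Complex.I * b + 1) * u) *
      (Complex.I ^ m * v * (2 * a + m + 2)) * hI
  rw [e1, e2]
  generalize 2 ^ m * u / (Complex.I ^ m * v) = W
  clear e1 e2 u1 u2 v1 v2
  generalize 2 * (a : ℂ) + 2 * m + 3 = D at *
  generalize 2 * (a : ℂ) + m + 2 = E at *
  field_simp
  linear_combination (-2 * W) * key - (m + 1) * (a + m + 2) * W * x ^ 2 * S₀ * hI
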